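/- If i, j, k, l are four distinct elements of {1,…,7} such that no three of them lie on a common line of the Fano plane, then in 𝒢 one has s_i s_j = s_k s_l. -/

import Mathlib

/-!
Symmetric generation of `M₂₂` (Hasan–Lim).  `G` is the quotient of the free
group on three generators `x, y, t` by the normal closure of the relators
`x^7, y^2, (xy)^3, [x,y]^4, t^2, [t^{x^2}, y x⁻¹], [t, y],
 (y t^{x^2})^5, (x y x^2 t^x)^5, (x t)^8`,
where `a ^ b := b⁻¹ a b` and `[a, b] := a⁻¹ b⁻¹ a b`.
-/

namespace M22

abbrev F := FreeGroup (Fin 3)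
def fx : F := FreeGroup.of 0
def fy : F := FreeGroup.of 1
def ft : F := FreeGroup.of 2

/-- conjugation `a ^ b = b⁻¹ * a * b` -/
def fconj (a b : F) : F := b⁻¹ * a * b
/-- commutator `[a, b] = a⁻¹ * b⁻¹ * a * b` -/
def fcomm (a b : F) : F := a⁻¹ * b⁻¹ * a * b

def rels : Set F :=
  {fx ^ 7, fy ^ 2, (fx * fy) ^ 3, (fcomm fx fy) ^ 4, ft ^ 2,
   fcomm (fconj ft (fx ^ 2)) (fy * fx⁻¹), fcomm ft fy,
   (fy * fconj ft (fx ^ 2)) ^ 5, (fx * fy * fx ^ 2 * fconj ft fx) ^ 5,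
   (fx * ft) ^ 8}

abbrev G := PresentedGroup rels

def x : G := PresentedGroup.of 0
def y : G := PresentedGroup.of 1
def t : G := PresentedGroup.of 2

/-- The symmetric generators `t₁, …, t₁₄`: for `1 ≤ i ≤ 7`, `tᵢ = t ^ (xⁱ)`,
and for `1 ≤ k ≤ 7`, `t₍₇₊ₖ₎ = t ^ (x⁵ y x^(k-1))`; the index is read modulo
`14` with representatives `1, …, 14`. -/
def tt (i : ℕ) : G :=
  let j := (i - 1) % 14 + 1
  if j ≤ 7 then (x ^ j)⁻¹ * t * x ^ j
  else (x ^ 5 * y * x ^ (j - 8))⁻¹ * t * (x ^ 5 * y * x ^ (j - 8))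

/-- `sᵢ = tᵢ t₍ᵢ₊₇₎`. -/
def s (i : ℕ) : G := tt i * tt (i + 7)

/-- the residue of `n` modulo `7`, taken in `{1, …, 7}` -/
def red7 (n : ℕ) : ℕ := (n - 1) % 7 + 1

/-- `{a, b, c}` is a line of the Fano plane on points `{1, …, 7}`; the lines
are the seven triples `{m, m+2, m+3}` for `m = 1, …, 7`, entries reduced
modulo `7` into `{1, …, 7}`. -/
def IsFanoLine (a b c : ℕ) : Prop :=
  ∃ m ∈ Finset.Icc 1 7,
    ({a, b, c} : Finset ℕ) = {red7 m, red7 (m + 2), red7 (m + 3)}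

/-! ### String rewriting in `G`

Words are lists of numbers: `0 ↦ x`, `1 ↦ x⁻¹`, `2 ↦ y` and `n ↦ t_{n-2}` for `3 ≤ n ≤ 16`. -/

/-- value of a letter -/
def ev : ℕ → G
  | 0 => x
  | 1 => x⁻¹
  | 2 => y
  | n + 3 => tt (n + 1)

/-- value of a word -/
def eval : List ℕ → G
  | [] => 1
  | a :: w => ev a * eval w

theorem eval_append (u v : List ℕ) : eval (u ++ v) = eval u * eval v := by
  induction u with
  | nil => simp [eval]
  | cons a u ih => simp [eval, ih, mul_assoc]

/-- A rewriting rule; the left side is stored reversed. -/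
abbrev Rule := List ℕ × List ℕ

def Sound (R : List Rule) : Prop := ∀ p ∈ R, eval p.1.reverse = eval p.2

/-- remove a prefix -/
def pre : List ℕ → List ℕ → Option (List ℕ)
  | [], s => some s
  | _ :: _, [] => none
  | a :: l, b :: s => bif Nat.beq a b then pre l s else none

theorem pre_eq {l s r : List ℕ} (h : pre l s = some r) : s = l ++ r := by
  induction l generalizing s with
  | nil => simpa [pre] using h
  | cons a l ih =>
    cases s with
    | nil => simp [pre] at h
    | cons b s =>
      simp only [pre] at h
      cases hb : Nat.beq a b with
      | false => simp [hb] at h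
      | true =>
        rw [hb] at h
        have := Nat.eq_of_beq_eq_true hb
        rw [this, ih h]
        rfl

/-- the first rule which applies at the top of the stack -/
def fire : List Rule → List ℕ → Option (List ℕ × List ℕ)
  | [], _ => none
  | p :: R, st =>
    match pre p.1 st with
    | some r => some (r, p.2)
    | none => fire R st

theorem fire_eq {R : List Rule} (hR : Sound R) {st s r : List ℕ} (h : fire R st = some (s, r)) :
    eval st.reverse = eval (s.reverse ++ r) := by
  induction R with
  | nil => simp [fire] at h
  | cons p R ih =>
    simp only [fire] at h
    cases hp : pre p.1 st with
    | none =>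
      rw [hp] at h
      exact ih (fun q hq => hR q (List.mem_cons_of_mem _ hq)) h
    | some q =>
      rw [hp] at h
      simp only [Option.some.injEq, Prod.mk.injEq] at h
      obtain ⟨rfl, rfl⟩ := h
      rw [pre_eq hp, List.reverse_append, eval_append, eval_append, hR p List.mem_cons_self]

/-- normalisation of `st.reverse ++ inp`, with fuel -/
def nrm (R : List Rule) : ℕ → List ℕ → List ℕ → List ℕ
  | 0, st, inp => st.reverse ++ inp
  | _ + 1, st, [] => st.reverse
  | n + 1, st, a :: inp =>
    match fire R (a :: st) with
    | none => nrm R n (a :: st) inp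
    | some q => nrm R n q.1 (q.2 ++ inp)

theorem nrm_eq {R : List Rule} (hR : Sound R) (n : ℕ) (st inp : List ℕ) :
    eval (nrm R n st inp) = eval (st.reverse ++ inp) := by
  induction n generalizing st inp with
  | zero => rfl
  | succ n ih =>
    cases inp with
    | nil => simp [nrm]
    | cons a inp =>
      simp only [nrm]
      cases hf : fire R (a :: st) with
      | none => simp [ih]
      | some q =>
        have := fire_eq hR (s := q.1) (r := q.2) hf
        simp only [ih]
        rw [← List.append_assoc, eval_append, ← this, ← eval_append]
        simp

def nf (R : List Rule) (w : List ℕ) : List ℕ := nrm R 2000 [] w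

theorem nf_eq {R : List Rule} (hR : Sound R) (w : List ℕ) : eval (nf R w) = eval w := by
  simp [nf, nrm_eq hR]

theorem eq_of_nf {R : List Rule} (hR : Sound R) {u v : List ℕ} (h : nf R u = nf R v) :
    eval u = eval v := by
  rw [← nf_eq hR u, h, nf_eq hR]

theorem Sound.append {R S : List Rule} (hR : Sound R) (hS : Sound S) : Sound (R ++ S) := by
  intro p hp
  rcases List.mem_append.1 hp with h | h
  exacts [hR p h, hS p h]

theorem Sound.single {l r : List ℕ} (h : eval l = eval r) : Sound [(l.reverse, r)] := by
  intro p hp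
  rw [List.mem_singleton.1 hp, List.reverse_reverse, h]

/-- the `i`-th rule -/
def rl (R : List Rule) (i : ℕ) : Rule := R.getD i ([], [])

theorem rl_eq {R : List Rule} (hR : Sound R) (i : ℕ) :
    eval (rl R i).1.reverse = eval (rl R i).2 := by
  unfold rl
  rw [List.getD_eq_getElem?_getD]
  cases h : R[i]? with
  | none => rfl
  | some p => exact hR p (List.mem_of_getElem? h)

/-- A critical pair: rule `i` between `A` and `C`, and rule `j` between `B` and `D`. -/
structure Crit where
  i : ℕ
  A : List ℕ
  C : List ℕ
  j : ℕ
  B : List ℕ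
  D : List ℕ
  flip : Bool

/-- Knuth–Bendix completion following a list of critical pairs -/
def complete : List Rule → List Crit → List Rule
  | R, [] => R
  | R, e :: es =>
    if e.A ++ (rl R e.i).1.reverse ++ e.C = e.B ++ (rl R e.j).1.reverse ++ e.D then
      let p := nf R (e.A ++ (rl R e.i).2 ++ e.C)
      let q := nf R (e.B ++ (rl R e.j).2 ++ e.D)
      complete (R ++ [bif e.flip then (q.reverse, p) else (p.reverse, q)]) es
    else R

theorem complete_sound {R : List Rule} (hR : Sound R) (es : List Crit) :
    Sound (complete R es) := by
  induction es generalizing R with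
  | nil => exact hR
  | cons e es ih =>
    simp only [complete]
    split_ifs with h
    · apply ih
      apply hR.append
      have key : eval (nf R (e.A ++ (rl R e.i).2 ++ e.C))
          = eval (nf R (e.B ++ (rl R e.j).2 ++ e.D)) := by
        rw [nf_eq hR, nf_eq hR]
        have := congrArg eval h
        simpa only [eval_append, rl_eq hR] using this
      cases e.flip with
      | false => exact Sound.single key
      | true => exact Sound.single key.symm
    · exact hR

/-! ### The relations -/

theorem rel_one {w : F} (h : w ∈ rels) : (PresentedGroup.mk rels w : G) = 1 :=
  PresentedGroup.one_of_mem h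

theorem mk_fx : (PresentedGroup.mk rels fx : G) = x := rfl
theorem mk_fy : (PresentedGroup.mk rels fy : G) = y := rfl
theorem mk_ft : (PresentedGroup.mk rels ft : G) = t := rfl

theorem x7 : x ^ 7 = 1 := by
  have h := rel_one (w := fx ^ 7) (by simp [rels])
  simpa only [map_pow, mk_fx] using h

theorem y2 : y * y = 1 := by
  have h := rel_one (w := fy ^ 2) (by simp [rels])
  rw [map_pow, mk_fy] at h
  rw [← pow_two]
  exact h

theorem t2 : t * t = 1 := by
  have h := rel_one (w := ft ^ 2) (by simp [rels])
  rw [map_pow, mk_ft] at h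
  rw [← pow_two]
  exact h

theorem xy3 : (x * y) ^ 3 = 1 := by
  have h := rel_one (w := (fx * fy) ^ 3) (by simp [rels])
  simpa only [map_pow, map_mul, mk_fx, mk_fy] using h

theorem comm4 : (x⁻¹ * y⁻¹ * x * y) ^ 4 = 1 := by
  have h := rel_one (w := (fcomm fx fy) ^ 4) (by simp [rels])
  simpa only [fcomm, map_pow, map_mul, map_inv, mk_fx, mk_fy] using h

theorem comm_ty : t⁻¹ * y⁻¹ * t * y = 1 := by
  have h := rel_one (w := fcomm ft fy) (by simp [rels])
  simpa only [fcomm, map_pow, map_mul, map_inv, mk_ft, mk_fy] using h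

theorem comm_tb : ((x ^ 2)⁻¹ * t * x ^ 2)⁻¹ * (y * x⁻¹)⁻¹ * ((x ^ 2)⁻¹ * t * x ^ 2) * (y * x⁻¹) = 1 := by
  have h := rel_one (w := fcomm (fconj ft (fx ^ 2)) (fy * fx⁻¹)) (by simp [rels])
  simpa only [fcomm, fconj, map_pow, map_mul, map_inv, mk_ft, mk_fy, mk_fx] using h

theorem rel5a : (y * ((x ^ 2)⁻¹ * t * x ^ 2)) ^ 5 = 1 := by
  have h := rel_one (w := (fy * fconj ft (fx ^ 2)) ^ 5) (by simp [rels])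
  simpa only [fconj, map_pow, map_mul, map_inv, mk_ft, mk_fy, mk_fx] using h

theorem rel5b : (x * y * x ^ 2 * (x⁻¹ * t * x)) ^ 5 = 1 := by
  have h := rel_one (w := (fx * fy * fx ^ 2 * fconj ft fx) ^ 5) (by simp [rels])
  simpa only [fconj, map_pow, map_mul, map_inv, mk_ft, mk_fy, mk_fx] using h

theorem y_inv : y⁻¹ = y := inv_eq_of_mul_eq_one_left y2
theorem t_inv : t⁻¹ = t := inv_eq_of_mul_eq_one_left t2

theorem tt7 : tt 7 = t := by simp [tt, x7]

theorem tt_sq (i : ℕ) : tt i * tt i = 1 := by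
  unfold tt
  dsimp only
  split_ifs
  · have : ∀ g : G, (g⁻¹ * t * g) * (g⁻¹ * t * g) = 1 := fun g => by
      have : (g⁻¹ * t * g) * (g⁻¹ * t * g) = g⁻¹ * (t * t) * g := by group
      rw [this, t2]; group
    exact this _
  · have : ∀ g : G, (g⁻¹ * t * g) * (g⁻¹ * t * g) = 1 := fun g => by
      have : (g⁻¹ * t * g) * (g⁻¹ * t * g) = g⁻¹ * (t * t) * g := by group
      rw [this, t2]; group
    exact this _

/-! ### Inverse words -/

def il : ℕ → ℕ
  | 0 => 1
  | 1 => 0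
  | n + 2 => n + 2

def iw (w : List ℕ) : List ℕ := (w.map il).reverse

theorem ev_il (a : ℕ) : ev (il a) = (ev a)⁻¹ := by
  match a with
  | 0 => rfl
  | 1 => simp [il, ev]
  | 2 => exact y_inv.symm
  | n + 3 => exact (inv_eq_of_mul_eq_one_left (tt_sq (n + 1))).symm

theorem eval_iw (w : List ℕ) : eval (iw w) = (eval w)⁻¹ := by
  induction w with
  | nil => simp [iw, eval]
  | cons a w ih =>
    have : iw (a :: w) = iw w ++ [il a] := by simp [iw]
    rw [this, eval_append, ih]
    simp [eval, ev_il]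

/-! ### The subgroup generated by `x` and `y` -/

def axRules : List Rule :=
  [
   ([1, 0], []), ([0, 1], []), ([2, 2], []), ([0, 2, 0], [2, 1, 2]), ([1, 2, 1], [2, 0, 2]),
   ([0, 0, 0, 0], [1, 1, 1]), ([1, 1, 1, 1], [0, 0, 0]),
   ([2, 0, 2, 1, 2, 0, 2, 1], [2, 1, 2, 0, 2, 1, 2, 0])]

theorem axRules_sound : Sound axRules := by
  have e1 : x * (y * x) = y * (x⁻¹ * y) := by
    have h := xy3
    have h2 : x * (y * x) = (x * y) ^ 3 * (y⁻¹ * x⁻¹ * y⁻¹) := by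
      simp [pow_succ, mul_assoc]
    rw [h2, h, y_inv]; group
  have e2 : x⁻¹ * (y * x⁻¹) = y * (x * y) := by
    have h := congrArg (fun z => z⁻¹) e1
    simp only [mul_inv_rev, inv_inv, y_inv] at h
    simpa only [mul_assoc] using h
  have e3 : x * (x * (x * x)) = x⁻¹ * (x⁻¹ * x⁻¹) := by
    have h : x * (x * (x * x)) = x ^ 7 * (x⁻¹ * (x⁻¹ * x⁻¹)) := by
      simp [pow_succ, mul_assoc]
    rw [h, x7, one_mul]
  have e4 : x⁻¹ * (x⁻¹ * (x⁻¹ * x⁻¹)) = x * (x * x) := by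
    have h := congrArg (fun z => z⁻¹) e3
    simp only [mul_inv_rev, inv_inv] at h
    simpa only [mul_assoc] using h
  have e5 : x⁻¹ * (y * (x * (y * (x⁻¹ * (y * (x * y))))))
      = y * (x⁻¹ * (y * (x * (y * (x⁻¹ * (y * x)))))) := by
    have h := comm4
    rw [y_inv] at h
    have h2 : x⁻¹ * (y * (x * (y * (x⁻¹ * (y * (x * y)))))) = (x⁻¹ * y * x * y) ^ 4 *
        (y⁻¹ * (x⁻¹ * (y⁻¹ * (x * (y⁻¹ * (x⁻¹ * (y⁻¹ * x))))))) := by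
      simp [pow_succ, mul_assoc]
    rw [h2, h, y_inv, one_mul]
  intro p hp
  simp only [axRules, List.mem_cons, List.not_mem_nil, or_false] at hp
  rcases hp with rfl | rfl | rfl | rfl | rfl | rfl | rfl | rfl <;>
    simp [eval, ev, y2, e1, e2, e3, e4, e5]

def crits : List Crit :=
  [
   ⟨3, [], [0, 0, 0], 5, [0, 2], [], false⟩, ⟨4, [], [1, 1, 1], 6, [1, 2], [], false⟩,
   ⟨5, [], [2, 0], 3, [0, 0, 0], [], true⟩, ⟨6, [], [2, 1], 4, [1, 1, 1], [], true⟩,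
   ⟨3, [], [0, 0, 2, 1, 2], 10, [0, 2], [], false⟩,
   ⟨4, [], [1, 1, 2, 0, 2], 11, [1, 2], [], false⟩,
   ⟨0, [], [2, 0, 2, 1, 2, 0, 2], 7, [0], [], true⟩,
   ⟨7, [], [0], 3, [1, 2, 0, 2, 1, 2], [], false⟩,
   ⟨2, [], [1, 2, 0, 2, 1, 2, 0, 0], 15, [2], [], false⟩,
   ⟨0, [], [2, 0, 2, 1, 2, 0, 0], 16, [0], [], true⟩, ⟨16, [], [0], 8, [1, 2, 0], [], false⟩,
   ⟨2, [], [1, 2, 0, 2, 1, 1, 2, 0], 18, [2], [], true⟩,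
   ⟨4, [], [2, 0, 2, 1, 2, 0, 2], 7, [1, 2], [], true⟩, ⟨11, [], [1, 2, 0], 20, [1], [], true⟩,
   ⟨20, [], [1], 0, [1, 1, 2, 0, 2, 1, 2], [], false⟩,
   ⟨2, [], [0, 0, 2, 1, 2, 0, 2, 1], 22, [2], [], false⟩,
   ⟨1, [], [0, 2, 1, 2, 0, 2, 1], 23, [1], [], true⟩, ⟨10, [], [0, 2, 1], 23, [0], [], true⟩,
   ⟨2, [], [0, 2, 1, 2, 0, 2, 1, 2], 24, [2], [], false⟩,
   ⟨26, [], [1], 4, [0, 2, 1, 2, 0, 2], [], false⟩,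
   ⟨2, [], [0, 2, 1, 2, 0, 2, 1, 1], 27, [2], [], false⟩,
   ⟨28, [], [1], 9, [0, 2, 1], [], false⟩,
   ⟨2, [], [0, 2, 1, 2, 0, 0, 2, 1], 29, [2], [], true⟩,
   ⟨3, [], [2, 1, 2, 0, 2, 1, 1], 28, [0, 2], [], true⟩,
   ⟨10, [], [0, 0, 2], 31, [0], [], true⟩, ⟨31, [], [2], 2, [0, 0, 2, 1, 2, 0, 0], [], false⟩,
   ⟨2, [], [1, 1, 2, 0, 2, 1, 1, 2], 33, [2], [], false⟩,
   ⟨11, [], [1, 1, 2], 34, [1], [], true⟩, ⟨3, [], [2, 1, 2, 0, 0, 2, 1], 29, [0], [], true⟩,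
   ⟨4, [], [2, 0, 2, 1, 1, 2, 0], 18, [1], [], true⟩,
   ⟨10, [], [0, 2, 1, 2], 26, [0, 0], [], false⟩,
   ⟨0, [], [1, 1, 2, 0, 0, 2, 1, 2], 38, [0], [], true⟩,
   ⟨10, [], [0, 2, 1, 1], 28, [0, 0], [], false⟩,
   ⟨0, [], [1, 1, 2, 0, 0, 2, 1, 1], 40, [0], [], true⟩,
   ⟨11, [], [1, 2, 0, 2], 7, [1, 1], [], false⟩,
   ⟨1, [], [0, 0, 2, 1, 1, 2, 0, 2], 42, [1], [], true⟩,
   ⟨11, [], [1, 2, 0, 0], 16, [1, 1], [], false⟩,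
   ⟨1, [], [0, 0, 2, 1, 1, 2, 0, 0], 44, [1], [], true⟩, ⟨12, [], [0, 2], 21, [2], [], false⟩,
   ⟨1, [], [2, 1, 1, 1, 2, 0, 0, 2], 46, [1], [], true⟩, ⟨12, [], [0, 0], 35, [2], [], false⟩,
   ⟨1, [], [2, 1, 1, 1, 2, 0, 0, 0], 48, [1], [], true⟩, ⟨13, [], [1, 2], 25, [2], [], false⟩,
   ⟨13, [], [1, 1], 32, [2], [], false⟩, ⟨18, [], [2], 13, [2, 1], [], false⟩,
   ⟨0, [], [2, 0, 0, 2, 1, 1, 1, 2], 52, [0], [], true⟩,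
   ⟨19, [], [0], 1, [2, 1, 2, 0, 0, 2, 1, 1], [], false⟩,
   ⟨0, [], [2, 0, 2, 1, 1, 2, 0, 0], 54, [0], [], true⟩, ⟨29, [], [2], 12, [2, 0], [], false⟩,
   ⟨31, [], [1, 2], 12, [0, 0], [], true⟩, ⟨32, [], [1], 9, [0, 2, 1, 1], [], false⟩,
   ⟨36, [], [1], 0, [0, 0, 2, 1, 1, 2, 0, 0], [], false⟩,
   ⟨2, [], [1, 1, 2, 0, 0, 2, 1, 1], 59, [2], [], true⟩, ⟨40, [], [1], 37, [1], [], true⟩,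
   ⟨52, [], [1], 4, [1, 2, 0, 0, 2, 1, 1], [], true⟩,
   ⟨56, [], [0], 3, [0, 2, 1, 1, 2, 0, 0], [], true⟩,
   ⟨2, [], [1, 1, 2, 0, 0, 0, 2, 1, 1], 63, [2], [], false⟩]

/-- a confluent rewriting system for the group of order 168 -/
def nRules : List Rule :=
  [
   ([1, 0], []), ([0, 1], []), ([2, 2], []), ([0, 2, 0], [2, 1, 2]), ([1, 2, 1], [2, 0, 2]),
   ([0, 0, 0, 0], [1, 1, 1]), ([1, 1, 1, 1], [0, 0, 0]),
   ([2, 0, 2, 1, 2, 0, 2, 1], [2, 1, 2, 0, 2, 1, 2, 0]), ([0, 0, 0, 2, 1, 2], [0, 2, 1, 1, 1]),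
   ([1, 1, 1, 2, 0, 2], [1, 2, 0, 0, 0]), ([2, 1, 2, 0, 0, 0], [1, 1, 1, 2, 0]),
   ([2, 0, 2, 1, 1, 1], [0, 0, 0, 2, 1]), ([2, 1, 2, 0, 0, 2, 1, 2], [0, 2, 1, 1, 1, 2, 0]),
   ([2, 0, 2, 1, 1, 2, 0, 2], [1, 2, 0, 0, 0, 2, 1]),
   ([0, 2, 1, 2, 0, 2, 1, 2, 0], [2, 0, 2, 1, 2, 0, 2]),
   ([0, 0, 2, 1, 2, 0, 2, 1, 2], [1, 2, 0, 2, 1, 1, 2]),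
   ([0, 0, 2, 1, 2, 0, 2, 1], [2, 1, 2, 0, 2, 1, 1, 2]),
   ([2, 1, 1, 2, 0, 2, 1, 2, 0], [2, 0, 2, 1, 2, 0, 0]),
   ([0, 2, 1, 1, 2, 0, 2, 1, 2], [1, 2, 0, 0, 2, 1, 1, 1]),
   ([1, 1, 1, 2, 0, 0, 2, 1, 2], [1, 2, 0, 2, 1, 1, 2, 0]),
   ([0, 2, 1, 2, 0, 2, 1, 1], [2, 0, 0, 2, 1, 2, 0, 2]),
   ([2, 0, 2, 1, 2, 0, 0, 2, 1], [0, 0, 0, 2, 1, 1, 2, 0]),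
   ([1, 2, 0, 2, 1, 2, 0, 0, 2], [1, 1, 2, 0, 2, 1, 2]),
   ([1, 2, 0, 2, 1, 2, 0, 0], [2, 1, 1, 2, 0, 2, 1, 2]),
   ([2, 1, 2, 0, 2, 1, 2, 0, 2], [0, 2, 1, 2, 0, 2, 1]),
   ([2, 1, 2, 0, 2, 1, 1, 2, 0], [1, 1, 1, 2, 0, 0, 2, 1]),
   ([2, 1, 2, 0, 2, 1, 2, 0], [2, 0, 2, 1, 2, 0, 2, 1]),
   ([1, 1, 2, 0, 2, 1, 2, 0, 2], [0, 2, 1, 2, 0, 0, 2]),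
   ([1, 1, 2, 0, 2, 1, 2, 0], [2, 0, 2, 1, 2, 0, 0, 2]),
   ([1, 2, 0, 0, 2, 1, 2, 0, 2], [0, 2, 1, 1, 2, 0, 0, 0]),
   ([0, 0, 0, 2, 1, 1, 2, 0, 2], [0, 2, 1, 2, 0, 0, 2, 1]),
   ([2, 0, 0, 2, 1, 2, 0, 0], [2, 1, 1, 2, 0, 2, 1, 1]),
   ([1, 1, 2, 0, 2, 1, 1, 2, 0], [1, 1, 1, 2, 0, 0, 0, 2]),
   ([2, 1, 1, 2, 0, 2, 1, 1, 2], [0, 0, 2, 1, 2, 0, 0]),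
   ([2, 1, 1, 2, 0, 2, 1, 1], [2, 0, 0, 2, 1, 2, 0, 0]),
   ([0, 0, 2, 1, 2, 0, 0, 2, 1], [0, 0, 0, 2, 1, 1, 1, 2]),
   ([0, 0, 0, 2, 1, 1, 2, 0, 0], [2, 1, 1, 2, 0, 0, 2, 1]),
   ([1, 1, 1, 2, 0, 0, 2, 1, 1], [2, 0, 0, 2, 1, 1, 2, 0]),
   ([2, 1, 2, 0, 0, 2, 1, 1, 1], [0, 2, 1, 1, 2, 0, 2, 1]),
   ([1, 2, 0, 2, 1, 1, 2, 0, 0], [1, 1, 2, 0, 0, 2, 1, 2]),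
   ([1, 1, 2, 0, 0, 2, 1, 1, 1], [0, 2, 1, 1, 2, 0, 0, 2]),
   ([2, 0, 0, 2, 1, 1, 2, 0, 0], [1, 1, 2, 0, 0, 2, 1, 1]),
   ([2, 0, 2, 1, 1, 2, 0, 0, 0], [1, 2, 0, 0, 2, 1, 2, 0]),
   ([0, 2, 1, 2, 0, 0, 2, 1, 1], [0, 0, 2, 1, 1, 2, 0, 2]),
   ([0, 0, 2, 1, 1, 2, 0, 0, 0], [1, 2, 0, 0, 2, 1, 1, 2]),
   ([2, 1, 1, 2, 0, 0, 2, 1, 1], [0, 0, 2, 1, 1, 2, 0, 0]),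
   ([2, 0, 0, 2, 1, 1, 1, 2, 0], [2, 0, 0, 0, 2, 1, 1, 2, 0]),
   ([0, 2, 1, 1, 2, 0, 0, 0, 2, 1], [2, 1, 1, 1, 2, 0, 0, 2]),
   ([0, 0, 0, 2, 1, 1, 1, 2, 0], [2, 0, 0, 0, 2, 1, 1, 1, 2]),
   ([2, 1, 1, 1, 2, 0, 0, 0, 2, 1], [2, 1, 1, 1, 2, 0, 0, 0]),
   ([2, 1, 1, 2, 0, 0, 0, 2, 1], [2, 1, 1, 1, 2, 0, 0, 2, 1]),
   ([1, 1, 1, 2, 0, 0, 0, 2, 1], [2, 1, 1, 1, 2, 0, 0, 0, 2]),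
   ([2, 1, 1, 1, 2, 0, 0, 2, 1], [2, 1, 1, 2, 0, 0, 0, 2, 1]),
   ([1, 2, 0, 0, 0, 2, 1, 1, 2, 0], [2, 0, 0, 2, 1, 1, 1, 2]),
   ([0, 0, 2, 1, 1, 2, 0, 2, 1], [2, 1, 2, 0, 0, 2, 1, 1]),
   ([1, 1, 2, 0, 0, 2, 1, 2, 0], [2, 0, 2, 1, 1, 2, 0, 0]),
   ([2, 0, 0, 0, 2, 1, 1, 2, 0], [2, 0, 0, 2, 1, 1, 1, 2, 0]),
   ([0, 2, 1, 1, 1, 2, 0, 0, 0], [2, 1, 1, 1, 2, 0, 0, 0, 2]),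
   ([1, 2, 0, 0, 0, 2, 1, 1, 1], [2, 0, 0, 0, 2, 1, 1, 1, 2]),
   ([1, 1, 2, 0, 0, 2, 1, 1, 2], [0, 0, 2, 1, 1, 2, 0, 0]),
   ([0, 0, 2, 1, 1, 2, 0, 0, 2], [1, 1, 2, 0, 0, 2, 1, 1]),
   ([0, 2, 1, 1, 2, 0, 0, 2, 1], [0, 2, 1, 1, 2, 0, 0, 2, 1]),
   ([2, 1, 2, 0, 0, 2, 1, 1, 2, 0], [2, 1, 1, 2, 0, 0, 0, 2, 1, 1]),
   ([1, 1, 2, 0, 0, 0, 2, 1, 1, 2], [2, 0, 0, 2, 1, 1, 1, 2, 0, 0]),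
   ([1, 1, 2, 0, 0, 0, 2, 1, 1], [0, 0, 2, 1, 1, 1, 2, 0, 0])]

theorem nRules_eq : complete axRules crits = nRules := by decide +kernel

theorem nRules_sound : Sound nRules := nRules_eq ▸ complete_sound axRules_sound crits

/-! ### The stabiliser of `t` -/

/-- adds normal forms of products to a list of words -/
def products (R : List Rule) : List (List ℕ) → List (ℕ × ℕ) → List (List ℕ)
  | S, [] => S
  | S, p :: ps => products R (S ++ [nf R (S.getD p.1 [] ++ S.getD p.2 [])]) ps

theorem products_comm {R : List Rule} (hR : Sound R) (S : List (List ℕ)) (ps : List (ℕ × ℕ))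
    (hS : ∀ w ∈ S, Commute t (eval w)) : ∀ w ∈ products R S ps, Commute t (eval w) := by
  induction ps generalizing S with
  | nil => exact hS
  | cons p ps ih =>
    apply ih
    intro w hw
    have hd : ∀ i, Commute t (eval (S.getD i [])) := by
      intro i
      rw [List.getD_eq_getElem?_getD]
      cases h : S[i]? with
      | none => exact Commute.one_right t
      | some p => exact hS p (List.mem_of_getElem? h)
    rcases List.mem_append.1 hw with h | h
    · exact hS w h
    · rw [List.mem_singleton.1 h, nf_eq hR, eval_append]
      exact (hd _).mul_right (hd _)

def stab : List (List ℕ) :=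
  [
   [2], [0, 0, 2, 1, 1, 1], [2, 0, 0, 2, 1, 1, 1], [0, 0, 2, 1, 1, 1, 2], [0, 0, 0, 2, 1, 1],
   [2, 0, 0, 2, 1, 1, 1, 2], [2, 0, 0, 0, 2, 1, 1], [2, 0, 0, 0, 2, 1, 1, 2],
   [0, 0, 0, 2, 1, 1, 2], [2, 1, 2, 0, 2, 1, 2, 0], [1, 2, 0, 2, 1, 2, 0]]

theorem stab_eq : products nRules [[2], [0, 0, 2, 1, 1, 1]]
  [
   (0, 1), (1, 0), (1, 1), (2, 0), (2, 1), (3, 1), (4, 0), (7, 1), (8, 1)] = stab := by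
  decide +kernel

theorem stab_comm : ∀ w ∈ stab, Commute t (eval w) := by
  rw [← stab_eq]
  apply products_comm nRules_sound
  have h1 : Commute t y := by
    have h := comm_ty
    have h2 : t * y = y * t * (t⁻¹ * y⁻¹ * t * y) := by group
    rw [h, mul_one] at h2
    exact h2
  have h3 : Commute t (x * (x * (y * (x⁻¹ * (x⁻¹ * x⁻¹))))) := by
    have h := comm_tb
    have h2 : t * (x * (x * (y * (x⁻¹ * (x⁻¹ * x⁻¹))))) = x * (x * (y * (x⁻¹ * (x⁻¹ * x⁻¹)))) * t *
       (x ^ 2 * (((x ^ 2)⁻¹ * t * x ^ 2)⁻¹ * (y * x⁻¹)⁻¹ * ((x ^ 2)⁻¹ * t * x ^ 2) * (y * x⁻¹))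
        * (x ^ 2)⁻¹) := by simp [pow_succ, mul_assoc]
    rw [h, mul_one, mul_inv_cancel, mul_one] at h2
    exact h2
  intro w hw
  simp only [List.mem_cons, List.not_mem_nil, or_false] at hw
  rcases hw with rfl | rfl
  · simpa [eval, ev] using h1
  · simpa [eval, ev] using h3

def tRules : List Rule :=
  [
   ([1, 0], []), ([0, 1], []), ([2, 2], []), ([0, 2, 0], [2, 1, 2]), ([1, 2, 1], [2, 0, 2]),
   ([0, 0, 0, 0], [1, 1, 1]), ([1, 1, 1, 1], [0, 0, 0]),
   ([2, 0, 2, 1, 2, 0, 2, 1], [2, 1, 2, 0, 2, 1, 2, 0]), ([0, 0, 0, 2, 1, 2], [0, 2, 1, 1, 1]),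
   ([1, 1, 1, 2, 0, 2], [1, 2, 0, 0, 0]), ([2, 1, 2, 0, 0, 0], [1, 1, 1, 2, 0]),
   ([2, 0, 2, 1, 1, 1], [0, 0, 0, 2, 1]), ([2, 1, 2, 0, 0, 2, 1, 2], [0, 2, 1, 1, 1, 2, 0]),
   ([2, 0, 2, 1, 1, 2, 0, 2], [1, 2, 0, 0, 0, 2, 1]),
   ([0, 2, 1, 2, 0, 2, 1, 2, 0], [2, 0, 2, 1, 2, 0, 2]),
   ([0, 0, 2, 1, 2, 0, 2, 1, 2], [1, 2, 0, 2, 1, 1, 2]),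
   ([0, 0, 2, 1, 2, 0, 2, 1], [2, 1, 2, 0, 2, 1, 1, 2]),
   ([2, 1, 1, 2, 0, 2, 1, 2, 0], [2, 0, 2, 1, 2, 0, 0]),
   ([0, 2, 1, 1, 2, 0, 2, 1, 2], [1, 2, 0, 0, 2, 1, 1, 1]),
   ([1, 1, 1, 2, 0, 0, 2, 1, 2], [1, 2, 0, 2, 1, 1, 2, 0]),
   ([0, 2, 1, 2, 0, 2, 1, 1], [2, 0, 0, 2, 1, 2, 0, 2]),
   ([2, 0, 2, 1, 2, 0, 0, 2, 1], [0, 0, 0, 2, 1, 1, 2, 0]),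
   ([1, 2, 0, 2, 1, 2, 0, 0, 2], [1, 1, 2, 0, 2, 1, 2]),
   ([1, 2, 0, 2, 1, 2, 0, 0], [2, 1, 1, 2, 0, 2, 1, 2]),
   ([2, 1, 2, 0, 2, 1, 2, 0, 2], [0, 2, 1, 2, 0, 2, 1]),
   ([2, 1, 2, 0, 2, 1, 1, 2, 0], [1, 1, 1, 2, 0, 0, 2, 1]),
   ([2, 1, 2, 0, 2, 1, 2, 0], [2, 0, 2, 1, 2, 0, 2, 1]),
   ([1, 1, 2, 0, 2, 1, 2, 0, 2], [0, 2, 1, 2, 0, 0, 2]),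
   ([1, 1, 2, 0, 2, 1, 2, 0], [2, 0, 2, 1, 2, 0, 0, 2]),
   ([1, 2, 0, 0, 2, 1, 2, 0, 2], [0, 2, 1, 1, 2, 0, 0, 0]),
   ([0, 0, 0, 2, 1, 1, 2, 0, 2], [0, 2, 1, 2, 0, 0, 2, 1]),
   ([2, 0, 0, 2, 1, 2, 0, 0], [2, 1, 1, 2, 0, 2, 1, 1]),
   ([1, 1, 2, 0, 2, 1, 1, 2, 0], [1, 1, 1, 2, 0, 0, 0, 2]),
   ([2, 1, 1, 2, 0, 2, 1, 1, 2], [0, 0, 2, 1, 2, 0, 0]),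
   ([2, 1, 1, 2, 0, 2, 1, 1], [2, 0, 0, 2, 1, 2, 0, 0]),
   ([0, 0, 2, 1, 2, 0, 0, 2, 1], [0, 0, 0, 2, 1, 1, 1, 2]),
   ([0, 0, 0, 2, 1, 1, 2, 0, 0], [2, 1, 1, 2, 0, 0, 2, 1]),
   ([1, 1, 1, 2, 0, 0, 2, 1, 1], [2, 0, 0, 2, 1, 1, 2, 0]),
   ([2, 1, 2, 0, 0, 2, 1, 1, 1], [0, 2, 1, 1, 2, 0, 2, 1]),
   ([1, 2, 0, 2, 1, 1, 2, 0, 0], [1, 1, 2, 0, 0, 2, 1, 2]),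
   ([1, 1, 2, 0, 0, 2, 1, 1, 1], [0, 2, 1, 1, 2, 0, 0, 2]),
   ([2, 0, 0, 2, 1, 1, 2, 0, 0], [1, 1, 2, 0, 0, 2, 1, 1]),
   ([2, 0, 2, 1, 1, 2, 0, 0, 0], [1, 2, 0, 0, 2, 1, 2, 0]),
   ([0, 2, 1, 2, 0, 0, 2, 1, 1], [0, 0, 2, 1, 1, 2, 0, 2]),
   ([0, 0, 2, 1, 1, 2, 0, 0, 0], [1, 2, 0, 0, 2, 1, 1, 2]),
   ([2, 1, 1, 2, 0, 0, 2, 1, 1], [0, 0, 2, 1, 1, 2, 0, 0]),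
   ([2, 0, 0, 2, 1, 1, 1, 2, 0], [2, 0, 0, 0, 2, 1, 1, 2, 0]),
   ([0, 2, 1, 1, 2, 0, 0, 0, 2, 1], [2, 1, 1, 1, 2, 0, 0, 2]),
   ([0, 0, 0, 2, 1, 1, 1, 2, 0], [2, 0, 0, 0, 2, 1, 1, 1, 2]),
   ([2, 1, 1, 1, 2, 0, 0, 0, 2, 1], [2, 1, 1, 1, 2, 0, 0, 0]),
   ([2, 1, 1, 2, 0, 0, 0, 2, 1], [2, 1, 1, 1, 2, 0, 0, 2, 1]),
   ([1, 1, 1, 2, 0, 0, 0, 2, 1], [2, 1, 1, 1, 2, 0, 0, 0, 2]),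
   ([2, 1, 1, 1, 2, 0, 0, 2, 1], [2, 1, 1, 2, 0, 0, 0, 2, 1]),
   ([1, 2, 0, 0, 0, 2, 1, 1, 2, 0], [2, 0, 0, 2, 1, 1, 1, 2]),
   ([0, 0, 2, 1, 1, 2, 0, 2, 1], [2, 1, 2, 0, 0, 2, 1, 1]),
   ([1, 1, 2, 0, 0, 2, 1, 2, 0], [2, 0, 2, 1, 1, 2, 0, 0]),
   ([2, 0, 0, 0, 2, 1, 1, 2, 0], [2, 0, 0, 2, 1, 1, 1, 2, 0]),
   ([0, 2, 1, 1, 1, 2, 0, 0, 0], [2, 1, 1, 1, 2, 0, 0, 0, 2]),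
   ([1, 2, 0, 0, 0, 2, 1, 1, 1], [2, 0, 0, 0, 2, 1, 1, 1, 2]),
   ([1, 1, 2, 0, 0, 2, 1, 1, 2], [0, 0, 2, 1, 1, 2, 0, 0]),
   ([0, 0, 2, 1, 1, 2, 0, 0, 2], [1, 1, 2, 0, 0, 2, 1, 1]),
   ([0, 2, 1, 1, 2, 0, 0, 2, 1], [0, 2, 1, 1, 2, 0, 0, 2, 1]),
   ([2, 1, 2, 0, 0, 2, 1, 1, 2, 0], [2, 1, 1, 2, 0, 0, 0, 2, 1, 1]),
   ([1, 1, 2, 0, 0, 0, 2, 1, 1, 2], [2, 0, 0, 2, 1, 1, 1, 2, 0, 0]),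
   ([1, 1, 2, 0, 0, 0, 2, 1, 1], [0, 0, 2, 1, 1, 1, 2, 0, 0]), ([2, 9], [2, 9]),
   ([1, 1, 1, 2, 0, 0, 9], [0, 0, 2, 1, 1, 1, 9]),
   ([1, 1, 1, 2, 0, 0, 2, 9], [2, 0, 0, 2, 1, 1, 1, 9]),
   ([2, 1, 1, 1, 2, 0, 0, 9], [0, 0, 2, 1, 1, 1, 2, 9]),
   ([1, 1, 2, 0, 0, 0, 9], [0, 0, 0, 2, 1, 1, 9]),
   ([2, 1, 1, 1, 2, 0, 0, 2, 9], [2, 0, 0, 2, 1, 1, 1, 2, 9]),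
   ([1, 1, 2, 0, 0, 0, 2, 9], [2, 0, 0, 0, 2, 1, 1, 9]),
   ([2, 1, 1, 2, 0, 0, 0, 2, 9], [2, 0, 0, 0, 2, 1, 1, 2, 9]),
   ([2, 1, 1, 2, 0, 0, 0, 9], [0, 0, 0, 2, 1, 1, 2, 9]),
   ([0, 2, 1, 2, 0, 2, 1, 2, 9], [2, 1, 2, 0, 2, 1, 2, 0, 9]),
   ([0, 2, 1, 2, 0, 2, 1, 9], [1, 2, 0, 2, 1, 2, 0, 9])]

theorem tRules_eq : tRules = nRules ++ stab.map fun h => ((9 :: h).reverse, h ++ [9]) := by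
  decide +kernel

theorem tRules_sound : Sound tRules := by
  rw [tRules_eq]
  apply nRules_sound.append
  intro p hp
  obtain ⟨h, hh, rfl⟩ := List.mem_map.1 hp
  have := stab_comm h hh
  simp only [List.reverse_reverse]
  rw [eval_append]
  simpa [eval, ev, tt7] using this.eq

/-! ### The action on the symmetric generators -/

/-- `t_{i+1} = t ^ (gw i)` -/
def gw (i : ℕ) : List ℕ :=
  bif Nat.ble i 6 then List.replicate (i + 1) 0
  else [0, 0, 0, 0, 0, 2] ++ List.replicate (i - 7) 0

theorem eval_replicate (n : ℕ) : eval (List.replicate n 0) = x ^ n := by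
  induction n with
  | zero => rfl
  | succ n ih => rw [List.replicate_succ, eval, ih, pow_succ']; rfl

theorem tt_gw (i : ℕ) (hi : i < 14) : tt (i + 1) = (eval (gw i))⁻¹ * t * eval (gw i) := by
  have hm : i % 14 = i := Nat.mod_eq_of_lt hi
  unfold tt gw
  simp only [Nat.add_sub_cancel, hm]
  by_cases h : i ≤ 6
  · have h' : Nat.ble i 6 = true := Nat.ble_eq_true_of_le h
    rw [if_pos (by omega), h', cond_true, eval_replicate]
  · have h' : Nat.ble i 6 = false := by
      cases hb : Nat.ble i 6 with
      | false => rfl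
      | true => exact absurd (Nat.le_of_ble_eq_true hb) h
    rw [if_neg (by omega), h', cond_false, eval_append, eval_replicate]
    have : eval [0, 0, 0, 0, 0, 2] = x ^ 5 * y := by
      simp [eval, ev, pow_succ, mul_assoc]
    rw [this, show i + 1 - 8 = i - 7 by omega]

/-- entry `3 * i + a` is the letter of `t_{i+1}` conjugated by the letter `a` -/
def actTable : List ℕ :=
  [
   4, 9, 14, 5, 3, 5, 6, 4, 4, 7, 5, 13, 8, 6, 10, 9, 7, 15, 3, 8, 9, 11, 16, 7, 12, 10, 12,
   13, 11, 11, 14, 12, 6, 15, 13, 3, 16, 14, 8, 10, 15, 16]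

def act (i a : ℕ) : ℕ := actTable.getD (3 * i + a) 3

def actOk (i a : ℕ) : Bool :=
  let j := act i a - 3
  decide (3 ≤ act i a ∧ j < 14 ∧
    nf tRules (iw (gw i) ++ [9] ++ gw i ++ [a] ++ iw (gw j)) = nf tRules ([a] ++ iw (gw j) ++ [9]))

theorem actOk_all : ∀ i < 14, ∀ a < 3, actOk i a = true := by decide +kernel

theorem act_eq (i : ℕ) (hi : i < 14) (a : ℕ) (ha : a < 3) :
    eval [i + 3, a] = eval [a, act i a] := by
  have h := of_decide_eq_true (actOk_all i hi a ha)
  obtain ⟨h3, h14, h⟩ := h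
  have h := eq_of_nf tRules_sound h
  obtain ⟨j, hj⟩ : ∃ j, act i a = j + 3 := ⟨act i a - 3, by omega⟩
  rw [hj] at h h14 ⊢
  rw [Nat.add_sub_cancel] at h h14
  simp only [eval_append, eval_iw] at h
  have e9 : eval [9] = t := by simp [eval, ev, tt7]
  have ea : eval [a] = ev a := by simp [eval]
  rw [e9, ea] at h
  simp only [eval, mul_one]
  change tt (i + 1) * ev a = ev a * tt (j + 1)
  rw [tt_gw i hi, tt_gw j h14]
  rw [mul_inv_eq_iff_eq_mul] at h
  rw [h]
  group

/-- normal forms `n * w` with `n` a word in `x, y` and `w` a word in the `t_i` -/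
def gRules : List Rule :=
  [
   ([1, 0], []), ([0, 1], []), ([2, 2], []), ([0, 2, 0], [2, 1, 2]), ([1, 2, 1], [2, 0, 2]),
   ([0, 0, 0, 0], [1, 1, 1]), ([1, 1, 1, 1], [0, 0, 0]),
   ([2, 0, 2, 1, 2, 0, 2, 1], [2, 1, 2, 0, 2, 1, 2, 0]), ([0, 0, 0, 2, 1, 2], [0, 2, 1, 1, 1]),
   ([1, 1, 1, 2, 0, 2], [1, 2, 0, 0, 0]), ([2, 1, 2, 0, 0, 0], [1, 1, 1, 2, 0]),
   ([2, 0, 2, 1, 1, 1], [0, 0, 0, 2, 1]), ([2, 1, 2, 0, 0, 2, 1, 2], [0, 2, 1, 1, 1, 2, 0]),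
   ([2, 0, 2, 1, 1, 2, 0, 2], [1, 2, 0, 0, 0, 2, 1]),
   ([0, 2, 1, 2, 0, 2, 1, 2, 0], [2, 0, 2, 1, 2, 0, 2]),
   ([0, 0, 2, 1, 2, 0, 2, 1, 2], [1, 2, 0, 2, 1, 1, 2]),
   ([0, 0, 2, 1, 2, 0, 2, 1], [2, 1, 2, 0, 2, 1, 1, 2]),
   ([2, 1, 1, 2, 0, 2, 1, 2, 0], [2, 0, 2, 1, 2, 0, 0]),
   ([0, 2, 1, 1, 2, 0, 2, 1, 2], [1, 2, 0, 0, 2, 1, 1, 1]),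
   ([1, 1, 1, 2, 0, 0, 2, 1, 2], [1, 2, 0, 2, 1, 1, 2, 0]),
   ([0, 2, 1, 2, 0, 2, 1, 1], [2, 0, 0, 2, 1, 2, 0, 2]),
   ([2, 0, 2, 1, 2, 0, 0, 2, 1], [0, 0, 0, 2, 1, 1, 2, 0]),
   ([1, 2, 0, 2, 1, 2, 0, 0, 2], [1, 1, 2, 0, 2, 1, 2]),
   ([1, 2, 0, 2, 1, 2, 0, 0], [2, 1, 1, 2, 0, 2, 1, 2]),
   ([2, 1, 2, 0, 2, 1, 2, 0, 2], [0, 2, 1, 2, 0, 2, 1]),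
   ([2, 1, 2, 0, 2, 1, 1, 2, 0], [1, 1, 1, 2, 0, 0, 2, 1]),
   ([2, 1, 2, 0, 2, 1, 2, 0], [2, 0, 2, 1, 2, 0, 2, 1]),
   ([1, 1, 2, 0, 2, 1, 2, 0, 2], [0, 2, 1, 2, 0, 0, 2]),
   ([1, 1, 2, 0, 2, 1, 2, 0], [2, 0, 2, 1, 2, 0, 0, 2]),
   ([1, 2, 0, 0, 2, 1, 2, 0, 2], [0, 2, 1, 1, 2, 0, 0, 0]),
   ([0, 0, 0, 2, 1, 1, 2, 0, 2], [0, 2, 1, 2, 0, 0, 2, 1]),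
   ([2, 0, 0, 2, 1, 2, 0, 0], [2, 1, 1, 2, 0, 2, 1, 1]),
   ([1, 1, 2, 0, 2, 1, 1, 2, 0], [1, 1, 1, 2, 0, 0, 0, 2]),
   ([2, 1, 1, 2, 0, 2, 1, 1, 2], [0, 0, 2, 1, 2, 0, 0]),
   ([2, 1, 1, 2, 0, 2, 1, 1], [2, 0, 0, 2, 1, 2, 0, 0]),
   ([0, 0, 2, 1, 2, 0, 0, 2, 1], [0, 0, 0, 2, 1, 1, 1, 2]),
   ([0, 0, 0, 2, 1, 1, 2, 0, 0], [2, 1, 1, 2, 0, 0, 2, 1]),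
   ([1, 1, 1, 2, 0, 0, 2, 1, 1], [2, 0, 0, 2, 1, 1, 2, 0]),
   ([2, 1, 2, 0, 0, 2, 1, 1, 1], [0, 2, 1, 1, 2, 0, 2, 1]),
   ([1, 2, 0, 2, 1, 1, 2, 0, 0], [1, 1, 2, 0, 0, 2, 1, 2]),
   ([1, 1, 2, 0, 0, 2, 1, 1, 1], [0, 2, 1, 1, 2, 0, 0, 2]),
   ([2, 0, 0, 2, 1, 1, 2, 0, 0], [1, 1, 2, 0, 0, 2, 1, 1]),
   ([2, 0, 2, 1, 1, 2, 0, 0, 0], [1, 2, 0, 0, 2, 1, 2, 0]),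
   ([0, 2, 1, 2, 0, 0, 2, 1, 1], [0, 0, 2, 1, 1, 2, 0, 2]),
   ([0, 0, 2, 1, 1, 2, 0, 0, 0], [1, 2, 0, 0, 2, 1, 1, 2]),
   ([2, 1, 1, 2, 0, 0, 2, 1, 1], [0, 0, 2, 1, 1, 2, 0, 0]),
   ([2, 0, 0, 2, 1, 1, 1, 2, 0], [2, 0, 0, 0, 2, 1, 1, 2, 0]),
   ([0, 2, 1, 1, 2, 0, 0, 0, 2, 1], [2, 1, 1, 1, 2, 0, 0, 2]),
   ([0, 0, 0, 2, 1, 1, 1, 2, 0], [2, 0, 0, 0, 2, 1, 1, 1, 2]),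
   ([2, 1, 1, 1, 2, 0, 0, 0, 2, 1], [2, 1, 1, 1, 2, 0, 0, 0]),
   ([2, 1, 1, 2, 0, 0, 0, 2, 1], [2, 1, 1, 1, 2, 0, 0, 2, 1]),
   ([1, 1, 1, 2, 0, 0, 0, 2, 1], [2, 1, 1, 1, 2, 0, 0, 0, 2]),
   ([2, 1, 1, 1, 2, 0, 0, 2, 1], [2, 1, 1, 2, 0, 0, 0, 2, 1]),
   ([1, 2, 0, 0, 0, 2, 1, 1, 2, 0], [2, 0, 0, 2, 1, 1, 1, 2]),
   ([0, 0, 2, 1, 1, 2, 0, 2, 1], [2, 1, 2, 0, 0, 2, 1, 1]),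
   ([1, 1, 2, 0, 0, 2, 1, 2, 0], [2, 0, 2, 1, 1, 2, 0, 0]),
   ([2, 0, 0, 0, 2, 1, 1, 2, 0], [2, 0, 0, 2, 1, 1, 1, 2, 0]),
   ([0, 2, 1, 1, 1, 2, 0, 0, 0], [2, 1, 1, 1, 2, 0, 0, 0, 2]),
   ([1, 2, 0, 0, 0, 2, 1, 1, 1], [2, 0, 0, 0, 2, 1, 1, 1, 2]),
   ([1, 1, 2, 0, 0, 2, 1, 1, 2], [0, 0, 2, 1, 1, 2, 0, 0]),
   ([0, 0, 2, 1, 1, 2, 0, 0, 2], [1, 1, 2, 0, 0, 2, 1, 1]),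
   ([0, 2, 1, 1, 2, 0, 0, 2, 1], [0, 2, 1, 1, 2, 0, 0, 2, 1]),
   ([2, 1, 2, 0, 0, 2, 1, 1, 2, 0], [2, 1, 1, 2, 0, 0, 0, 2, 1, 1]),
   ([1, 1, 2, 0, 0, 0, 2, 1, 1, 2], [2, 0, 0, 2, 1, 1, 1, 2, 0, 0]),
   ([1, 1, 2, 0, 0, 0, 2, 1, 1], [0, 0, 2, 1, 1, 1, 2, 0, 0]), ([0, 3], [0, 4]),
   ([1, 3], [1, 9]), ([2, 3], [2, 14]), ([0, 4], [0, 5]), ([1, 4], [1, 3]), ([2, 4], [2, 5]),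
   ([0, 5], [0, 6]), ([1, 5], [1, 4]), ([2, 5], [2, 4]), ([0, 6], [0, 7]), ([1, 6], [1, 5]),
   ([2, 6], [2, 13]), ([0, 7], [0, 8]), ([1, 7], [1, 6]), ([2, 7], [2, 10]), ([0, 8], [0, 9]),
   ([1, 8], [1, 7]), ([2, 8], [2, 15]), ([0, 9], [0, 3]), ([1, 9], [1, 8]), ([2, 9], [2, 9]),
   ([0, 10], [0, 11]), ([1, 10], [1, 16]), ([2, 10], [2, 7]), ([0, 11], [0, 12]),
   ([1, 11], [1, 10]), ([2, 11], [2, 12]), ([0, 12], [0, 13]), ([1, 12], [1, 11]),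
   ([2, 12], [2, 11]), ([0, 13], [0, 14]), ([1, 13], [1, 12]), ([2, 13], [2, 6]),
   ([0, 14], [0, 15]), ([1, 14], [1, 13]), ([2, 14], [2, 3]), ([0, 15], [0, 16]),
   ([1, 15], [1, 14]), ([2, 15], [2, 8]), ([0, 16], [0, 10]), ([1, 16], [1, 15]),
   ([2, 16], [2, 16]), ([3, 3], []), ([4, 4], []), ([5, 5], []), ([6, 6], []), ([7, 7], []),
   ([8, 8], []), ([9, 9], []), ([10, 10], []), ([11, 11], []), ([12, 12], []), ([13, 13], []),
   ([14, 14], []), ([15, 15], []), ([16, 16], [])]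

theorem gRules_eq : gRules = nRules ++ ((List.range 14).flatMap fun i => (List.range 3).map fun a =>
    ([i + 3, a].reverse, [a, act i a])) ++ (List.range 14).map fun i => ([i + 3, i + 3], []) := by
  decide +kernel

theorem gRules_sound : Sound gRules := by
  rw [gRules_eq]
  refine (nRules_sound.append ?_).append ?_
  · intro p hp
    obtain ⟨i, hi, hp⟩ := List.mem_flatMap.1 hp
    obtain ⟨a, ha, rfl⟩ := List.mem_map.1 hp
    rw [List.reverse_reverse]
    exact act_eq i (List.mem_range.1 hi) a (List.mem_range.1 ha)
  · intro p hp
    obtain ⟨i, hi, rfl⟩ := List.mem_map.1 hp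
    have := tt_sq (i + 1)
    simpa [eval, ev] using this

/-- the rules `gRules`, sorted by the last two letters of the left side -/
def table : List (List (List Rule)) :=
  [
   [[([0, 0, 0, 0], [1, 1, 1]), ([0, 0, 0, 2, 1, 2], [0, 2, 1, 1, 1]), ([0, 0, 2, 1, 2, 0, 2, 1, 2], [1, 2, 0, 2, 1, 1, 2]), ([0, 0, 2, 1, 2, 0, 2, 1], [2, 1, 2, 0, 2, 1, 1, 2]), ([0, 0, 0, 2, 1, 1, 2, 0, 2], [0, 2, 1, 2, 0, 0, 2, 1]), ([0, 0, 2, 1, 2, 0, 0, 2, 1], [0, 0, 0, 2, 1, 1, 1, 2]), ([0, 0, 0, 2, 1, 1, 2, 0, 0], [2, 1, 1, 2, 0, 0, 2, 1]), ([0, 0, 2, 1, 1, 2, 0, 0, 0], [1, 2, 0, 0, 2, 1, 1, 2]), ([0, 0, 0, 2, 1, 1, 1, 2, 0], [2, 0, 0, 0, 2, 1, 1, 1, 2]), ([0, 0, 2, 1, 1, 2, 0, 2, 1], [2, 1, 2, 0, 0, 2, 1, 1]), ([0, 0, 2, 1, 1, 2, 0, 0, 2], [1, 1, 2, 0, 0,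 2, 1, 1])],
    [([0, 1], [])],
    [([0, 2, 0], [2, 1, 2]), ([0, 2, 1, 2, 0, 2, 1, 2, 0], [2, 0, 2, 1, 2, 0, 2]), ([0, 2, 1, 1, 2, 0, 2, 1, 2], [1, 2, 0, 0, 2, 1, 1, 1]), ([0, 2, 1, 2, 0, 2, 1, 1], [2, 0, 0, 2, 1, 2, 0, 2]), ([0, 2, 1, 2, 0, 0, 2, 1, 1], [0, 0, 2, 1, 1, 2, 0, 2]), ([0, 2, 1, 1, 2, 0, 0, 0, 2, 1], [2, 1, 1, 1, 2, 0, 0, 2]), ([0, 2, 1, 1, 1, 2, 0, 0, 0], [2, 1, 1, 1, 2, 0, 0, 0, 2]), ([0, 2, 1, 1, 2, 0, 0, 2, 1], [0, 2, 1, 1, 2, 0, 0, 2, 1])],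
    [([0, 3], [0, 4])], [([0, 4], [0, 5])], [([0, 5], [0, 6])], [([0, 6], [0, 7])],
    [([0, 7], [0, 8])], [([0, 8], [0, 9])], [([0, 9], [0, 3])], [([0, 10], [0, 11])],
    [([0, 11], [0, 12])], [([0, 12], [0, 13])], [([0, 13], [0, 14])], [([0, 14], [0, 15])],
    [([0, 15], [0, 16])], [([0, 16], [0, 10])]],
   [[([1, 0], [])],
    [([1, 1, 1, 1], [0, 0, 0]), ([1, 1, 1, 2, 0, 2], [1, 2, 0, 0, 0]), ([1, 1, 1, 2, 0, 0, 2, 1, 2], [1, 2, 0, 2, 1, 1, 2, 0]), ([1, 1, 2, 0, 2, 1, 2, 0, 2], [0, 2, 1, 2, 0, 0, 2]), ([1, 1, 2, 0, 2, 1, 2, 0], [2, 0, 2, 1, 2, 0, 0, 2]), ([1, 1, 2, 0, 2, 1, 1, 2, 0], [1, 1, 1, 2, 0, 0, 0, 2]), ([1, 1, 1, 2, 0, 0, 2, 1, 1], [2, 0, 0, 2, 1, 1, 2, 0]), ([1, 1, 2, 0, 0, 2, 1, 1, 1], [0, 2, 1, 1, 2, 0, 0, 2]), ([1, 1, 1,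 2, 0, 0, 0, 2, 1], [2, 1, 1, 1, 2, 0, 0, 0, 2]), ([1, 1, 2, 0, 0, 2, 1, 2, 0], [2, 0, 2, 1, 1, 2, 0, 0]), ([1, 1, 2, 0, 0, 2, 1, 1, 2], [0, 0, 2, 1, 1, 2, 0, 0]), ([1, 1, 2, 0, 0, 0, 2, 1, 1, 2], [2, 0, 0, 2, 1, 1, 1, 2, 0, 0]), ([1, 1, 2, 0, 0, 0, 2, 1, 1], [0, 0, 2, 1, 1, 1, 2, 0, 0])],
    [([1, 2, 1], [2, 0, 2]), ([1, 2, 0, 2, 1, 2, 0, 0, 2], [1, 1, 2, 0, 2, 1, 2]), ([1, 2, 0, 2, 1, 2, 0, 0], [2, 1, 1, 2, 0, 2, 1, 2]), ([1, 2, 0, 0, 2, 1, 2, 0, 2], [0, 2, 1, 1, 2, 0, 0, 0]), ([1, 2, 0, 2, 1, 1, 2, 0, 0], [1, 1, 2, 0, 0, 2, 1, 2]), ([1, 2, 0, 0, 0, 2, 1, 1, 2, 0], [2, 0, 0, 2, 1, 1, 1, 2]), ([1, 2, 0, 0, 0, 2, 1, 1, 1], [2, 0, 0, 0, 2, 1,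 1, 1, 2])],
    [([1, 3], [1, 9])], [([1, 4], [1, 3])], [([1, 5], [1, 4])], [([1, 6], [1, 5])],
    [([1, 7], [1, 6])], [([1, 8], [1, 7])], [([1, 9], [1, 8])], [([1, 10], [1, 16])],
    [([1, 11], [1, 10])], [([1, 12], [1, 11])], [([1, 13], [1, 12])], [([1, 14], [1, 13])],
    [([1, 15], [1, 14])], [([1, 16], [1, 15])]],
   [[([2, 0, 2, 1, 2, 0, 2, 1], [2, 1, 2, 0, 2, 1, 2, 0]), ([2, 0, 2, 1, 1, 1], [0, 0, 0, 2, 1]), ([2, 0, 2, 1, 1, 2, 0, 2], [1, 2, 0, 0, 0, 2, 1]), ([2, 0, 2, 1, 2, 0, 0, 2, 1], [0, 0, 0, 2, 1, 1, 2, 0]), ([2, 0, 0, 2, 1, 2, 0, 0], [2, 1, 1, 2, 0, 2, 1, 1]), ([2, 0, 0, 2, 1, 1, 2, 0, 0], [1, 1, 2, 0, 0, 2, 1, 1]), ([2, 0, 2, 1, 1, 2, 0, 0, 0], [1, 2, 0, 0, 2, 1, 2, 0]), ([2, 0, 0, 2, 1, 1, 1, 2, 0], [2, 0, 0, 0, 2,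 1, 1, 2, 0]), ([2, 0, 0, 0, 2, 1, 1, 2, 0], [2, 0, 0, 2, 1, 1, 1, 2, 0])],
    [([2, 1, 2, 0, 0, 0], [1, 1, 1, 2, 0]), ([2, 1, 2, 0, 0, 2, 1, 2], [0, 2, 1, 1, 1, 2, 0]), ([2, 1, 1, 2, 0, 2, 1, 2, 0], [2, 0, 2, 1, 2, 0, 0]), ([2, 1, 2, 0, 2, 1, 2, 0, 2], [0, 2, 1, 2, 0, 2, 1]), ([2, 1, 2, 0, 2, 1, 1, 2, 0], [1, 1, 1, 2, 0, 0, 2, 1]), ([2, 1, 2, 0, 2, 1, 2, 0], [2, 0, 2, 1, 2, 0, 2, 1]), ([2, 1, 1, 2, 0, 2, 1, 1, 2], [0, 0, 2, 1, 2, 0, 0]), ([2, 1, 1, 2, 0, 2, 1, 1], [2, 0, 0, 2, 1, 2, 0, 0]), ([2, 1, 2, 0, 0, 2, 1, 1, 1], [0, 2, 1, 1, 2, 0, 2, 1]), ([2, 1, 1, 2, 0, 0, 2, 1, 1], [0, 0, 2, 1, 1, 2, 0, 0]), ([2, 1, 1, 1, 2, 0, 0, 0, 2, 1], [2, 1, 1,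 1, 2, 0, 0, 0]), ([2, 1, 1, 2, 0, 0, 0, 2, 1], [2, 1, 1, 1, 2, 0, 0, 2, 1]), ([2, 1, 1, 1, 2, 0, 0, 2, 1], [2, 1, 1, 2, 0, 0, 0, 2, 1]), ([2, 1, 2, 0, 0, 2, 1, 1, 2, 0], [2, 1, 1, 2, 0, 0, 0, 2, 1, 1])],
    [([2, 2], [])], [([2, 3], [2, 14])], [([2, 4], [2, 5])], [([2, 5], [2, 4])],
    [([2, 6], [2, 13])], [([2, 7], [2, 10])], [([2, 8], [2, 15])], [([2, 9], [2, 9])],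
    [([2, 10], [2, 7])], [([2, 11], [2, 12])], [([2, 12], [2, 11])], [([2, 13], [2, 6])],
    [([2, 14], [2, 3])], [([2, 15], [2, 8])], [([2, 16], [2, 16])]],
   [[], [], [], [([3, 3], [])], [], [], [], [], [], [], [], [], [], [], [], [], []],
   [[], [], [], [], [([4, 4], [])], [], [], [], [], [], [], [], [], [], [], [], []],
   [[], [], [], [], [], [([5, 5], [])], [], [], [], [], [], [], [], [], [], [], []],
   [[], [], [], [], [], [], [([6, 6], [])], [], [], [], [], [], [], [], [], [], []],
   [[], [], [], [], [], [], [], [([7, 7], [])], [], [], [], [], [], [], [], [], []],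
   [[], [], [], [], [], [], [], [], [([8, 8], [])], [], [], [], [], [], [], [], []],
   [[], [], [], [], [], [], [], [], [], [([9, 9], [])], [], [], [], [], [], [], []],
   [[], [], [], [], [], [], [], [], [], [], [([10, 10], [])], [], [], [], [], [], []],
   [[], [], [], [], [], [], [], [], [], [], [], [([11, 11], [])], [], [], [], [], []],
   [[], [], [], [], [], [], [], [], [], [], [], [], [([12, 12], [])], [], [], [], []],
   [[], [], [], [], [], [], [], [], [], [], [], [], [], [([13, 13], [])], [], [], []],
   [[], [], [], [], [], [], [], [], [], [], [], [], [], [], [([14, 14], [])], [], []],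
   [[], [], [], [], [], [], [], [], [], [], [], [], [], [], [], [([15, 15], [])], []],
   [[], [], [], [], [], [], [], [], [], [], [], [], [], [], [], [], [([16, 16], [])]]]

/-- the rules which may apply below the top letter `a` -/
def cell (a : ℕ) : List ℕ → List Rule
  | [] => []
  | b :: _ => (table.getD a []).getD b []

theorem table_sub : ∀ p ∈ table.flatten.flatten, p ∈ gRules := by decide +kernel

theorem getD_mem {α : Type*} (L : List (List α)) (i : ℕ) : ∀ p ∈ L.getD i [], p ∈ L.flatten := by
  intro p hp
  rw [List.getD_eq_getElem?_getD] at hp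
  cases h : L[i]? with
  | none => simp [h] at hp
  | some l =>
    rw [h] at hp
    exact List.mem_flatten.2 ⟨l, List.mem_of_getElem? h, hp⟩

theorem cell_sound (a : ℕ) (st : List ℕ) : Sound (cell a st) := by
  intro p hp
  cases st with
  | nil => simp [cell] at hp
  | cons b st =>
    have h := getD_mem _ b p hp
    obtain ⟨l, hl, hp⟩ := List.mem_flatten.1 h
    exact gRules_sound p (table_sub p (List.mem_flatten.2 ⟨l, getD_mem _ a l hl, hp⟩))

/-- normalisation of `st.reverse ++ inp` by means of `table`, with fuel -/
def gnrm : ℕ → List ℕ → List ℕ → List ℕ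
  | 0, st, inp => st.reverse ++ inp
  | _ + 1, st, [] => st.reverse
  | n + 1, st, a :: inp =>
    match fire (cell a st) (a :: st) with
    | none => gnrm n (a :: st) inp
    | some q => gnrm n q.1 (q.2 ++ inp)

theorem gnrm_eq (n : ℕ) (st inp : List ℕ) :
    eval (gnrm n st inp) = eval (st.reverse ++ inp) := by
  induction n generalizing st inp with
  | zero => rfl
  | succ n ih =>
    cases inp with
    | nil => simp [gnrm]
    | cons a inp =>
      simp only [gnrm]
      cases hf : fire (cell a st) (a :: st) with
      | none => simp [ih]
      | some q =>
        have := fire_eq (cell_sound a st) (s := q.1) (r := q.2) hf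
        simp only [ih]
        rw [← List.append_assoc, eval_append, ← this, ← eval_append]
        simp

/-- normal form in `G` -/
def gnf (w : List ℕ) : List ℕ := gnrm 2000 [] w

theorem gnf_eq (w : List ℕ) : eval (gnf w) = eval w := by
  simp [gnf, gnrm_eq]

/-! ### Consequences of the relations -/

/-- product of conjugates of known relators or their inverses -/
def conjProd (Fs : List (List ℕ)) : List (ℕ × Bool × List ℕ) → List ℕ
  | [] => []
  | c :: cs =>
    iw c.2.2 ++ (bif c.2.1 then Fs.getD c.1 [] else iw (Fs.getD c.1 [])) ++ c.2.2 ++ conjProd Fs cs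

theorem conjProd_eq {Fs : List (List ℕ)} (hF : ∀ w ∈ Fs, eval w = 1)
    (cs : List (ℕ × Bool × List ℕ)) : eval (conjProd Fs cs) = 1 := by
  have hd : ∀ i, eval (Fs.getD i []) = 1 := by
    intro i
    rw [List.getD_eq_getElem?_getD]
    cases h : Fs[i]? with
    | none => rfl
    | some p => exact hF p (List.mem_of_getElem? h)
  induction cs with
  | nil => rfl
  | cons c cs ih =>
    simp only [conjProd, eval_append, ih, eval_iw]
    cases c.2.1
    · rw [cond_false, eval_iw, hd]; group
    · rw [cond_true, hd]; group

/-- equality test for words -/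
def weq : List ℕ → List ℕ → Bool
  | [], [] => true
  | a :: u, b :: v => bif Nat.beq a b then weq u v else false
  | _, _ => false

theorem weq_eq {u v : List ℕ} (h : weq u v = true) : u = v := by
  induction u generalizing v with
  | nil =>
    cases v with
    | nil => rfl
    | cons b v => simp [weq] at h
  | cons a u ih =>
    cases v with
    | nil => simp [weq] at h
    | cons b v =>
      simp only [weq] at h
      cases hb : Nat.beq a b with
      | false => simp [hb] at h
      | true =>
        rw [hb] at h
        rw [Nat.eq_of_beq_eq_true hb, ih h]

/-- check that each word of the last list is a consequence of the words before it -/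
def derives : List (List ℕ) → List (List (ℕ × Bool × List ℕ)) → List (List ℕ) → Bool
  | _, _, [] => true
  | _, [], _ :: _ => false
  | Fs, cs :: css, f :: fs =>
    bif weq (gnf (conjProd Fs cs)) f then derives (Fs ++ [f]) css fs else false

theorem derives_eq (Fs : List (List ℕ)) (css : List (List (ℕ × Bool × List ℕ)))
    (fs : List (List ℕ)) (hF : ∀ w ∈ Fs, eval w = 1) (h : derives Fs css fs = true) :
    ∀ w ∈ fs, eval w = 1 := by
  induction fs generalizing Fs css with
  | nil => simp
  | cons f fs ih =>
    cases css with
    | nil => simp [derives] at h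
    | cons cs css =>
      simp only [derives] at h
      cases hb : weq (gnf (conjProd Fs cs)) f with
      | false => simp [hb] at h
      | true =>
        rw [hb] at h
        have hf : eval f = 1 := by
          rw [← weq_eq hb, gnf_eq, conjProd_eq hF]
        intro w hw
        rcases List.mem_cons.1 hw with rfl | hw
        · exact hf
        · refine ih (Fs ++ [f]) css ?_ h w hw
          intro v hv
          rcases List.mem_append.1 hv with hv | hv
          · exact hF v hv
          · rw [List.mem_singleton.1 hv, hf]

def derivation : List (List (ℕ × Bool × List ℕ)) :=
  [
   [(0, true, [])], [(1, true, [])], [(2, false, [2, 1]), (3, true, [1, 1, 1, 2, 0, 0, 2])],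
   [(4, false, [0, 2, 1, 10]), (4, true, [2, 1, 1, 10])],
   [(5, false, [1, 2, 0, 0, 0, 8, 5, 12, 15, 11]), (3, true, [2, 1, 2, 0, 2, 1, 1, 2])],
   [(6, true, [2, 0, 0, 2, 1, 1, 2, 5, 12, 8, 3, 12, 5, 4]), (4, true, [2, 0, 0, 0, 2, 1, 1, 1, 5, 11, 12, 5, 4])],
   [(5, false, [2, 0, 0, 0, 2, 1, 1, 1, 2, 3]), (2, true, [2, 1])],
   [(8, true, [2, 0, 2, 1, 1, 2, 0, 0, 2, 5, 12, 15, 11, 12, 5, 3]), (4, true, [0, 0, 2, 1, 5, 10, 12, 5, 3])],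
   [(9, false, [0, 2, 1, 12, 5, 11, 15, 10, 12, 5, 4]), (4, true, [2, 0, 0, 0, 2, 1, 1, 1, 5, 11, 12, 5, 4])],
   [(10, true, [0, 0, 2, 1, 2, 0, 2, 8, 14, 7]), (4, true, [2, 0, 2, 1, 1, 2, 0, 0, 7, 8, 14, 7])],
   [(7, true, [1, 2, 0, 0, 2, 1, 4, 8, 12, 5, 4, 3, 15]), (11, true, [0, 2, 1, 15])],
   [(12, true, [1, 1, 1, 2, 16, 9, 15, 11, 13, 6, 4]), (4, true, [0, 0, 2, 6, 11, 13, 6, 4])],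
   [(4, false, [0, 2, 1, 10]), (13, true, [2, 0, 0, 0, 2, 1, 1, 2, 3, 10])],
   [(4, false, [0, 2, 1, 10, 11]), (4, true, [1, 1, 2, 0, 0, 0, 2, 1, 10, 4, 3, 10, 11])],
   [(15, true, [])], [(15, true, [0])], [(15, true, [0, 0])], [(15, true, [0, 0, 0])],
   [(15, true, [1, 1, 1])], [(15, true, [1, 1])], [(15, true, [1])],
   [(14, false, [2, 1, 2, 0, 0, 2, 3])], [(14, false, [2, 1, 2, 0, 2, 1, 2, 4])],
   [(14, false, [2, 1, 2, 0, 2, 1, 2, 0, 5])], [(14, false, [1, 2, 0, 2, 1, 1, 2, 6])],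
   [(14, false, [1, 2, 0, 2, 1, 1, 2, 0, 7])], [(14, false, [2, 1, 2, 0, 0, 2, 1, 1, 8])],
   [(14, false, [2, 1, 2, 0, 0, 2, 1, 9])]]

def facts : List (List ℕ) :=
  [
   [2, 4, 5, 4, 5, 4], [2, 1, 2, 0, 3, 14, 10, 7, 3],
   [2, 0, 0, 2, 1, 2, 0, 0, 11, 3, 11, 4, 10, 11], [0, 2, 1, 1, 16, 3, 10, 9, 12, 10, 3, 5],
   [0, 2, 1, 1, 1, 2, 0, 0, 16, 9, 10, 4, 9, 16, 15, 4, 8],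
   [2, 0, 0, 2, 1, 2, 0, 0, 3, 4, 12, 5, 3, 8, 11, 12, 5],
   [2, 1, 1, 1, 2, 0, 0, 0, 2, 12, 5, 15, 10, 5, 12, 4, 3, 4],
   [4, 3, 12, 5, 11, 15, 10, 12, 5],
   [2, 1, 1, 1, 2, 0, 0, 0, 2, 8, 5, 12, 11, 10, 15, 11, 12, 5],
   [0, 2, 1, 1, 2, 0, 3, 15, 4, 3, 15], [0, 0, 0, 2, 1, 1, 6, 13, 15, 10, 9, 16, 3, 4],
   [2, 0, 0, 2, 1, 1, 2, 3, 12, 5, 3, 13, 6], [11, 3, 10, 15, 8, 4], [3, 10, 3, 10],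
   [3, 10, 3, 10], [4, 11, 4, 11], [5, 12, 5, 12], [6, 13, 6, 13], [7, 14, 7, 14],
   [8, 15, 8, 15], [9, 16, 9, 16], [3, 10, 4, 11, 8, 15], [4, 11, 5, 12, 9, 16],
   [5, 12, 6, 13, 3, 10], [6, 13, 7, 14, 4, 11], [7, 14, 8, 15, 5, 12], [8, 15, 9, 16, 6, 13],
   [9, 16, 3, 10, 7, 14]]

/-- the two relators we start from -/
def start : List (List ℕ) :=
  [[2, 4, 2, 4, 2, 4, 2, 4, 2, 4],
   [0, 2, 0, 0, 3, 0, 2, 0, 0, 3, 0, 2, 0, 0, 3, 0, 2, 0, 0, 3, 0, 2, 0, 0, 3]]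

theorem facts_ok : derives start derivation facts = true := by
  decide +kernel

theorem facts_one : ∀ w ∈ facts, eval w = 1 := by
  apply derives_eq start derivation facts ?_ facts_ok
  intro w hw
  simp only [start, List.mem_cons, List.not_mem_nil, or_false] at hw
  rcases hw with rfl | rfl
  · have h : tt 2 = (x ^ 2)⁻¹ * t * x ^ 2 := by simp [tt]
    have h5 := rel5a
    rw [← h] at h5
    refine Eq.trans ?_ h5
    simp only [eval, ev, pow_succ, pow_zero, mul_assoc, one_mul, mul_one,
      Nat.reduceAdd]
  · have h : tt 1 = x⁻¹ * t * x := by simp [tt]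
    have h5 := rel5b
    rw [← h] at h5
    refine Eq.trans ?_ h5
    simp only [eval, ev, pow_succ, pow_zero, mul_assoc, one_mul, mul_one, zero_add,
      Nat.reduceAdd]

/-! ### The elements `s_i` -/

theorem s_sq : ∀ i ∈ Finset.Icc 1 7, s i * s i = 1 := by
  have key : ∀ i ∈ Finset.Icc 1 7, [i + 2, i + 9, i + 2, i + 9] ∈ facts := by decide
  intro i hi
  have h := facts_one _ (key i hi)
  obtain ⟨j, rfl⟩ : ∃ j, i = j + 1 := ⟨i - 1, by have := Finset.mem_Icc.1 hi; omega⟩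
  have e : s (j + 1) = ev (j + 1 + 2) * ev (j + 1 + 9) := rfl
  rw [e, ← h]
  simp only [eval, mul_assoc, mul_one]

theorem s_line : ∀ i ∈ Finset.Icc 1 7, s i * s (red7 (i + 1)) * s (red7 (i + 5)) = 1 := by
  have key : ∀ i ∈ Finset.Icc 1 7, [i + 2, i + 9, red7 (i + 1) + 2, red7 (i + 1) + 9,
      red7 (i + 5) + 2, red7 (i + 5) + 9] ∈ facts := by decide
  intro i hi
  have h := facts_one _ (key i hi)
  obtain ⟨j, rfl⟩ : ∃ j, i = j + 1 := ⟨i - 1, by have := Finset.mem_Icc.1 hi; omega⟩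
  have e : ∀ j, s (j + 1) = ev (j + 1 + 2) * ev (j + 1 + 9) := fun _ => rfl
  rw [← h]
  unfold red7
  rw [e, e, e]
  simp only [eval, mul_assoc, mul_one]

/-- six products from `abc = 1` with involutions -/
theorem six {a b c : G} (ha : a * a = 1) (hb : b * b = 1) (hc : c * c = 1) (h : a * b * c = 1) :
    a * b = c ∧ b * a = c ∧ b * c = a ∧ c * b = a ∧ a * c = b ∧ c * a = b := by
  have ia : a⁻¹ = a := inv_eq_of_mul_eq_one_left ha
  have ib : b⁻¹ = b := inv_eq_of_mul_eq_one_left hb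
  have ic : c⁻¹ = c := inv_eq_of_mul_eq_one_left hc
  have h1 : a * b = c := by rw [← ic]; exact eq_inv_of_mul_eq_one_left h
  have h2 : b * a = c := by rw [← ic, ← h1, mul_inv_rev, ia, ib]
  refine ⟨h1, h2, ?_, ?_, ?_, ?_⟩
  · rw [← h2, ← mul_assoc, hb, one_mul]
  · rw [← h1, mul_assoc, hb, mul_one]
  · rw [← h1, ← mul_assoc, ha, one_mul]
  · rw [← h2, mul_assoc, ha, mul_one]

/-- The third point on the line through two points. -/
def third (i j : ℕ) : ℕ :=
  match (j + 7 - i) % 7 with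
  | 1 => red7 (i + 5)
  | 2 => red7 (i + 3)
  | 3 => red7 (i + 2)
  | 4 => red7 (i + 6)
  | 5 => red7 (i + 1)
  | _ => red7 (i + 4)

theorem s_mul : ∀ i ∈ Finset.Icc 1 7, ∀ j ∈ Finset.Icc 1 7, i ≠ j → s i * s j = s (third i j) := by
  have key : ∀ m ∈ Finset.Icc 1 7, s m * s (red7 (m + 1)) = s (red7 (m + 5)) ∧
      s (red7 (m + 1)) * s m = s (red7 (m + 5)) ∧ s (red7 (m + 1)) * s (red7 (m + 5)) = s m ∧
      s (red7 (m + 5)) * s (red7 (m + 1)) = s m ∧ s m * s (red7 (m + 5)) = s (red7 (m + 1)) ∧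
      s (red7 (m + 5)) * s m = s (red7 (m + 1)) := by
    intro m hm
    have hr : ∀ n, red7 n ∈ Finset.Icc 1 7 := by
      intro n
      have := Nat.mod_lt (n - 1) (show 0 < 7 by norm_num)
      simp only [red7, Finset.mem_Icc]
      omega
    exact six (s_sq _ hm) (s_sq _ (hr _)) (s_sq _ (hr _)) (s_line m hm)
  have comb : ∀ i ∈ Finset.Icc 1 7, ∀ j ∈ Finset.Icc 1 7, i ≠ j → ∃ m ∈ Finset.Icc 1 7,
      (i, j, third i j) ∈ [(m, red7 (m + 1), red7 (m + 5)), (red7 (m + 1), m, red7 (m + 5)),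
        (red7 (m + 1), red7 (m + 5), m), (red7 (m + 5), red7 (m + 1), m),
        (m, red7 (m + 5), red7 (m + 1)), (red7 (m + 5), m, red7 (m + 1))] := by decide +kernel
  intro i hi j hj hij
  obtain ⟨m, hm, h⟩ := comb i hi j hj hij
  obtain ⟨k1, k2, k3, k4, k5, k6⟩ := key m hm
  simp only [List.mem_cons, List.not_mem_nil, or_false, Prod.mk.injEq] at h
  rcases h with ⟨h1, h2, h3⟩ | ⟨h1, h2, h3⟩ | ⟨h1, h2, h3⟩ | ⟨h1, h2, h3⟩ | ⟨h1, h2, h3⟩ |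
    ⟨h1, h2, h3⟩ <;> rw [h3, h1, h2] <;> assumption

theorem third_line : ∀ i ∈ Finset.Icc 1 7, ∀ j ∈ Finset.Icc 1 7, i ≠ j →
    IsFanoLine i j (third i j) := by
  unfold IsFanoLine
  decide +kernel

theorem third_quad : ∀ i ∈ Finset.Icc 1 7, ∀ j ∈ Finset.Icc 1 7,
      ∀ k ∈ Finset.Icc 1 7, ∀ l ∈ Finset.Icc 1 7,
        i ≠ j → i ≠ k → i ≠ l → j ≠ k → j ≠ l → k ≠ l →
        third i j ≠ k → third i j ≠ l → third k l ≠ i → third k l ≠ j → third i j = third k l := by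
  decide +kernel


/-- If `i, j, k, l` are four distinct points of the Fano plane no three of
which are collinear, then `sᵢ sⱼ = sₖ sₗ` in `G`. -/
theorem s_prods :
    ∀ i ∈ Finset.Icc 1 7, ∀ j ∈ Finset.Icc 1 7,
      ∀ k ∈ Finset.Icc 1 7, ∀ l ∈ Finset.Icc 1 7,
        i ≠ j → i ≠ k → i ≠ l → j ≠ k → j ≠ l → k ≠ l →
        (∀ a ∈ ({i, j, k, l} : Finset ℕ), ∀ b ∈ ({i, j, k, l} : Finset ℕ),
          ∀ c ∈ ({i, j, k, l} : Finset ℕ),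
            a ≠ b → a ≠ c → b ≠ c → ¬ IsFanoLine a b c) →
        s i * s j = s k * s l := by
  intro i hi j hj k hk l hl hij hik hil hjk hjl hkl h
  rw [s_mul i hi j hj hij, s_mul k hk l hl hkl]
  have mi : i ∈ ({i, j, k, l} : Finset ℕ) := by simp
  have mj : j ∈ ({i, j, k, l} : Finset ℕ) := by simp
  have mk : k ∈ ({i, j, k, l} : Finset ℕ) := by simp
  have ml : l ∈ ({i, j, k, l} : Finset ℕ) := by simp
  have L1 := third_line i hi j hj hij
  have L2 := third_line k hk l hl hkl
  rw [third_quad i hi j hj k hk l hl hij hik hil hjk hjl hkl]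
  · intro e
    exact h i mi j mj k mk hij hik hjk (e ▸ L1)
  · intro e
    exact h i mi j mj l ml hij hil hjl (e ▸ L1)
  · intro e
    exact h k mk l ml i mi hkl hik.symm hil.symm (e ▸ L2)
  · intro e
    exact h k mk l ml j mj hkl hjk.symm hjl.symm (e ▸ L2)


end M22
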